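/- Let s > 0, and let k ∈ ℕ be the integer with s ∈ [k−1, k). Let α > s−1, β > −1, and n ∈ ℕ. Then the generalized Jacobi function ^+J_n^{(−α,β)}(x) = (1−x)^α P_n^{(α,β)}(x) is an eigenfunction of the fractional Sturm–Liouville operator: for every x ∈ (−1, 1), D_−^s[ (1−·)^{−α+s}(1+·)^{β+s} · D_+^s[(1−·)^α P_n^{(α,β)}] ](x) = λ_{n,s}^{(α,β)} · (1+x)^β P_n^{(α,β)}(x), where λ_{n,s}^{(α,β)} = [Γ(n+α+1) Γ(n+β+s+1)] / [Γ(n+α−s+1) Γ(n+β+1)]. -/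

import Mathlib

open MeasureTheory Filter Finset

/-- Jacobi polynomial with real parameters. -/
noncomputable def jacobiP (a b : ℝ) (n : ℕ) (x : ℝ) : ℝ :=
  ∑ j ∈ Finset.range (n + 1),
    ((ascPochhammer ℝ j).eval ((n : ℝ) + a + b + 1) / (Nat.factorial j : ℝ)) *
      ((ascPochhammer ℝ (n - j)).eval (a + (j : ℝ) + 1) / (Nat.factorial (n - j) : ℝ)) *
      ((x - 1) / 2) ^ j

/-- Right Riemann-Liouville fractional integral on (-1,1). -/
noncomputable def Iplus (ρ : ℝ) (v : ℝ → ℝ) (x : ℝ) : ℝ :=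
  (1 / Real.Gamma ρ) * ∫ y in x..1, (y - x) ^ (ρ - 1) * v y

/-- Left Riemann-Liouville fractional integral on (-1,1). -/
noncomputable def Iminus (ρ : ℝ) (v : ℝ → ℝ) (x : ℝ) : ℝ :=
  (1 / Real.Gamma ρ) * ∫ y in (-1 : ℝ)..x, (x - y) ^ (ρ - 1) * v y

/-- Right Riemann-Liouville fractional derivative of order `s ∈ [k-1,k)`. -/
noncomputable def Dplus (s : ℝ) (k : ℕ) (v : ℝ → ℝ) (x : ℝ) : ℝ :=
  (-1 : ℝ) ^ k * iteratedDeriv k (Iplus ((k : ℝ) - s) v) x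

/-- Left Riemann-Liouville fractional derivative of order `s ∈ [k-1,k)`. -/
noncomputable def Dminus (s : ℝ) (k : ℕ) (v : ℝ → ℝ) (x : ℝ) : ℝ :=
  iteratedDeriv k (Iminus ((k : ℝ) - s) v) x


lemma vander (x y : ℝ) (N : ℕ) :
    (ascPochhammer ℝ N).eval (x + y) = ∑ ij ∈ antidiagonal N,
      (Nat.choose N ij.1 : ℝ) * ((ascPochhammer ℝ ij.1).eval x * (ascPochhammer ℝ ij.2).eval y) := by
  induction N with
  | zero => simp
  | succ k ih =>
    rw [sum_antidiagonal_choose_succ_mul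
      (fun i j => (ascPochhammer ℝ i).eval x * (ascPochhammer ℝ j).eval y),
      ← sum_add_distrib, ascPochhammer_succ_eval, ih, sum_mul]
    refine sum_congr rfl ?_
    intro ij hij
    rw [HasAntidiagonal.mem_antidiagonal] at hij
    rw [ascPochhammer_succ_eval, ascPochhammer_succ_eval, ← hij]
    have : (Nat.choose (ij.1 + ij.2) ij.2 : ℝ) = (Nat.choose (ij.1 + ij.2) ij.1 : ℝ) := by
      rw [Nat.choose_symm_add]
    push_cast
    rw [this]
    ring

lemma vander' (x y : ℝ) (N : ℕ) :
    (ascPochhammer ℝ N).eval (x + y) / (Nat.factorial N : ℝ) = ∑ i ∈ range (N + 1),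
      ((ascPochhammer ℝ i).eval x / (Nat.factorial i : ℝ)) *
      ((ascPochhammer ℝ (N - i)).eval y / (Nat.factorial (N - i) : ℝ)) := by
  rw [vander, Finset.Nat.sum_antidiagonal_eq_sum_range_succ
    (fun i j => (Nat.choose N i : ℝ) * ((ascPochhammer ℝ i).eval x * (ascPochhammer ℝ j).eval y)),
    sum_div]
  refine sum_congr rfl ?_
  intro i hi
  have hi' : i ≤ N := by simpa [Nat.lt_succ_iff] using hi
  rw [Nat.cast_choose ℝ hi']
  have h1 : (Nat.factorial N : ℝ) ≠ 0 := by positivity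
  have h2 : (Nat.factorial i : ℝ) ≠ 0 := by positivity
  have h3 : (Nat.factorial (N - i) : ℝ) ≠ 0 := by positivity
  field_simp

lemma asc_refl (y : ℝ) (r : ℕ) :
    (ascPochhammer ℝ r).eval (-y - r + 1) = (-1) ^ r * (ascPochhammer ℝ r).eval y := by
  induction r generalizing y with
  | zero => simp
  | succ r ih =>
    rw [ascPochhammer_succ_eval]
    have h := ih (y + 1)
    have e : -(y + 1) - (r : ℝ) + 1 = -y - ((r + 1 : ℕ) : ℝ) + 1 := by push_cast; ring
    rw [e] at h
    rw [h, ascPochhammer_succ_left]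
    simp only [Polynomial.eval_mul, Polynomial.eval_X, Polynomial.eval_comp, Polynomial.eval_add,
      Polynomial.eval_one]
    push_cast
    ring

lemma asc_add (x : ℝ) (m i : ℕ) :
    (ascPochhammer ℝ (m + i)).eval x =
      (ascPochhammer ℝ m).eval x * (ascPochhammer ℝ i).eval (x + m) := by
  rw [← ascPochhammer_mul]
  simp [Polynomial.eval_comp]

lemma jacobi_neg (a b : ℝ) (n : ℕ) (x : ℝ) :
    jacobiP a b n (-x) = (-1) ^ n * jacobiP b a n x := by
  unfold jacobiP
  have key : ∀ m ∈ range (n + 1),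
      ((ascPochhammer ℝ m).eval ((n : ℝ) + b + a + 1) / (Nat.factorial m : ℝ)) *
      ((ascPochhammer ℝ (n - m)).eval (b + (m : ℝ) + 1) / (Nat.factorial (n - m) : ℝ)) *
      ((x - 1) / 2) ^ m = ∑ j ∈ Finset.Ico m (n + 1), (-1) ^ (n + j) * 
        (((ascPochhammer ℝ j).eval ((n : ℝ) + a + b + 1) / (Nat.factorial j : ℝ)) *
      ((ascPochhammer ℝ (n - j)).eval (a + (j : ℝ) + 1) / (Nat.factorial (n - j) : ℝ))) *
      (((x - 1) / 2) ^ m * (j.choose m : ℝ)) := by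
    intro m hm
    have hm' : m ≤ n := by simpa [Nat.lt_succ_iff] using hm
    obtain ⟨N, rfl⟩ := Nat.exists_eq_add_of_le hm'
    rw [Finset.sum_Ico_eq_sum_range]
    have e1 : m + N + 1 - m = N + 1 := by omega
    have e2 : m + N - m = N := by omega
    rw [e1, e2]
    have e3 : b + (m : ℝ) + 1 = (((m + N : ℕ) : ℝ) + a + b + 1 + m) + (-a - (m + N : ℕ)) := by ring
    rw [e3, vander' (((m + N : ℕ) : ℝ) + a + b + 1 + m), mul_sum, sum_mul]
    refine sum_congr rfl ?_
    intro i hi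
    have hi' : i ≤ N := by simpa [Nat.lt_succ_iff] using hi
    obtain ⟨r, rfl⟩ := Nat.exists_eq_add_of_le hi'
    have e4 : i + r - i = r := by omega
    have e5 : m + (i + r) - (m + i) = r := by omega
    rw [e4, e5, asc_add]
    have e6 : -a - ((m + (i + r) : ℕ) : ℝ) = -(a + ((m + i : ℕ) : ℝ) + 1) - (r : ℝ) + 1 := by
      push_cast; ring
    rw [e6, asc_refl, Nat.cast_choose ℝ (Nat.le_add_right m i)]
    have e7 : m + i - m = i := by omega
    have e8 : (-1 : ℝ) ^ (m + (i + r) + (m + i)) = (-1) ^ r := by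
      rw [show m + (i + r) + (m + i) = 2 * (m + i) + r by ring, pow_add, pow_mul]; simp
    rw [e7, e8]
    have e9 : ((m + (i + r) : ℕ) : ℝ) + b + a + 1 = ((m + (i + r) : ℕ) : ℝ) + a + b + 1 := by ring
    rw [e9]
    have h1 : (Nat.factorial m : ℝ) ≠ 0 := by positivity
    have h2 : (Nat.factorial i : ℝ) ≠ 0 := by positivity
    have h3 : (Nat.factorial (m + i) : ℝ) ≠ 0 := by positivity
    field_simp
  rw [sum_congr rfl key, range_eq_Ico, Finset.sum_Ico_Ico_comm, mul_sum]
  refine sum_congr rfl ?_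
  intro j hj
  rw [← mul_sum]
  have : ((-x - 1) / 2) ^ j = (-1) ^ j * ∑ m ∈ Finset.Ico 0 (j + 1), ((x - 1) / 2) ^ m * (j.choose m : ℝ) := by
    rw [show (-x - 1) / 2 = (-1) * ((x - 1) / 2 + 1) by ring, mul_pow, add_pow, ← range_eq_Ico]
    simp
  have h1 : ((-1 : ℝ) ^ n) * (-1) ^ n = 1 := by rw [← mul_pow]; simp
  rw [this, pow_add, ← mul_assoc ((-1 : ℝ) ^ n), ← mul_assoc ((-1 : ℝ) ^ n),
    ← mul_assoc ((-1 : ℝ) ^ n), h1]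
  ring

lemma beta_real (a u v : ℝ) (ha : 0 < a) (hu : 0 < u) (hv : 0 < v) :
    ∫ t in (0 : ℝ)..a, t ^ (u - 1) * (a - t) ^ (v - 1) =
      a ^ (u + v - 1) * (Real.Gamma u * Real.Gamma v / Real.Gamma (u + v)) := by
  have h := Complex.betaIntegral_scaled u v ha
  rw [Complex.betaIntegral_eq_Gamma_mul_div (u : ℂ) v (by simpa) (by simpa)] at h
  rw [← Complex.ofReal_add, Complex.Gamma_ofReal, Complex.Gamma_ofReal, Complex.Gamma_ofReal] at h
  have e : ∫ t in (0 : ℝ)..a, (t : ℂ) ^ ((u : ℂ) - 1) * ((a : ℂ) - t) ^ ((v : ℂ) - 1) =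
      ∫ t in (0 : ℝ)..a, ((t ^ (u - 1) * (a - t) ^ (v - 1) : ℝ) : ℂ) := by
    refine intervalIntegral.integral_congr ?_
    intro t ht
    rw [Set.uIcc_of_le ha.le] at ht
    simp only
    rw [Complex.ofReal_mul, Complex.ofReal_cpow ht.1, Complex.ofReal_cpow (by linarith [ht.2])]
    push_cast
    rfl
  rw [e, intervalIntegral.integral_ofReal] at h
  have e2 : (a : ℂ) ^ (((u + v : ℝ) : ℂ) - 1) = ((a ^ (u + v - 1) : ℝ) : ℂ) := by
    rw [Complex.ofReal_cpow ha.le]; push_cast; rfl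
  rw [e2] at h
  exact_mod_cast h

lemma beta_shift (x ρ a : ℝ) (hx : x < 1) (hρ : 0 < ρ) (ha : -1 < a) :
    ∫ y in x..1, (y - x) ^ (ρ - 1) * (1 - y) ^ a =
      (1 - x) ^ (a + ρ) * (Real.Gamma ρ * Real.Gamma (a + 1) / Real.Gamma (a + ρ + 1)) := by
  have h := beta_real (1 - x) ρ (a + 1) (by linarith) hρ (by linarith)
  have h2 := intervalIntegral.integral_comp_sub_right (a := x) (b := 1)
    (fun t => t ^ (ρ - 1) * (1 - x - t) ^ (a + 1 - 1)) x
  rw [sub_self, h] at h2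
  rw [show a + ρ = ρ + (a + 1) - 1 by ring, show ρ + (a + 1) - 1 + 1 = ρ + (a + 1) by ring, ← h2]
  refine intervalIntegral.integral_congr ?_
  intro t _
  simp only
  congr 2 <;> ring

lemma beta_int (x ρ a : ℝ) (hx : x < 1) (hρ : 0 < ρ) (ha : -1 < a) :
    IntervalIntegrable (fun y => (y - x) ^ (ρ - 1) * (1 - y) ^ a) volume x 1 := by
  apply intervalIntegral.intervalIntegrable_of_integral_ne_zero
  rw [beta_shift x ρ a hx hρ ha]
  have h0 : 0 < 1 - x := by linarith
  have h1 := Real.Gamma_pos_of_pos hρ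
  have h2 := Real.Gamma_pos_of_pos (show 0 < a + 1 by linarith)
  have h3 := Real.Gamma_pos_of_pos (show 0 < a + ρ + 1 by linarith)
  positivity

lemma gamma_asc (a : ℝ) (ha : 0 < a) (m : ℕ) :
    Real.Gamma (a + m) = (ascPochhammer ℝ m).eval a * Real.Gamma a := by
  induction m with
  | zero => simp
  | succ m ih =>
    rw [ascPochhammer_succ_eval, Nat.cast_succ, ← add_assoc, Real.Gamma_add_one (by positivity), ih]
    ring

lemma iter_pow (p : ℝ) (hp : -1 < p) (k : ℕ) (y : ℝ) (hy : y < 1) :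
    (-1 : ℝ) ^ k * iteratedDeriv k (fun x => (1 - x) ^ (p + k)) y =
      Real.Gamma (p + k + 1) / Real.Gamma (p + 1) * (1 - y) ^ p := by
  induction k with
  | zero =>
    have h3 := Real.Gamma_pos_of_pos (show 0 < p + 1 by linarith)
    simp [div_self h3.ne']
  | succ k ih =>
    rw [iteratedDeriv_succ']
    have e : deriv (fun x : ℝ => (1 - x) ^ (p + ((k + 1 : ℕ) : ℝ))) =ᶠ[nhds y]
        fun x => (-(p + k + 1)) * (1 - x) ^ (p + k) := by
      filter_upwards [Iio_mem_nhds hy] with x hx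
      have hx' : (1 - x) ≠ 0 := by
        have : x < 1 := hx
        linarith
      have := ((hasDerivAt_id x).const_sub 1).rpow_const (p := p + ((k + 1 : ℕ) : ℝ)) (Or.inl hx')
      have := this.deriv
      simp only [id] at this
      rw [this]
      push_cast
      rw [show p + ((k : ℝ) + 1) - 1 = p + k by ring]
      ring
    rw [e.iteratedDeriv_eq, iteratedDeriv_const_mul_field]
    have hpos : 0 < p + k + 1 := by
      have : (0 : ℝ) ≤ k := Nat.cast_nonneg k
      linarith
    rw [show p + ((k + 1 : ℕ) : ℝ) + 1 = (p + k + 1) + 1 by push_cast; ring,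
      Real.Gamma_add_one hpos.ne']
    calc _ = (p + k + 1) * ((-1 : ℝ) ^ k * iteratedDeriv k (fun x => (1 - x) ^ (p + k)) y) := by
          ring
      _ = _ := by rw [ih]; ring

lemma Dplus_jacobi (s : ℝ) (k : ℕ) (hk2 : s < k) (a b C : ℝ) (hs : 0 < s) (ha : s - 1 < a)
    (n : ℕ) (v : ℝ → ℝ)
    (hv : ∀ z ∈ Set.Ioo (-1 : ℝ) 1, v z = C * ((1 - z) ^ a * jacobiP a b n z))
    (y : ℝ) (hy : y ∈ Set.Ioo (-1 : ℝ) 1) :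
    Dplus s k v y = C * (Real.Gamma (n + a + 1) / Real.Gamma (n + a - s + 1) *
      ((1 - y) ^ (a - s) * jacobiP (a - s) (b + s) n y)) := by
  set c : ℕ → ℝ := fun j => ((ascPochhammer ℝ j).eval ((n : ℝ) + a + b + 1) / (Nat.factorial j : ℝ)) *
      ((ascPochhammer ℝ (n - j)).eval (a + (j : ℝ) + 1) / (Nat.factorial (n - j) : ℝ)) *
      (-1 / 2) ^ j with hc
  have hρ : 0 < (k : ℝ) - s := by linarith
  have hgρ := Real.Gamma_pos_of_pos hρ
  have hj : ∀ j : ℕ, -1 < a + j := fun j => by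
    have : (0 : ℝ) ≤ j := Nat.cast_nonneg j
    linarith
  have hI : ∀ x ∈ Set.Ioo (-1 : ℝ) 1, Iplus ((k : ℝ) - s) v x =
      ∑ j ∈ range (n + 1), (C * c j * (Real.Gamma (a + j + 1) / Real.Gamma (a + j - s + k + 1))) *
        (1 - x) ^ (a + j - s + k) := by
    intro x hx
    unfold Iplus
    have e : ∫ z in x..1, (z - x) ^ ((k : ℝ) - s - 1) * v z =
        ∫ z in x..1, ∑ j ∈ range (n + 1),
          C * c j * ((z - x) ^ ((k : ℝ) - s - 1) * (1 - z) ^ (a + j)) := by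
      apply intervalIntegral.integral_congr_ae
      have hne : ∀ᵐ z : ℝ, z ≠ 1 := by simp [ae_iff]
      filter_upwards [hne] with z hz1 hz
      rw [Set.uIoc_of_le hx.2.le] at hz
      have hz2 : z < 1 := lt_of_le_of_ne hz.2 hz1
      rw [hv z ⟨by linarith [hx.1, hz.1], hz2⟩]
      unfold jacobiP
      rw [mul_sum, mul_sum, mul_sum]
      refine sum_congr rfl ?_
      intro j _
      rw [Real.rpow_add (by linarith), Real.rpow_natCast, hc,
        show (z - 1) / 2 = (-1 / 2) * (1 - z) by ring, mul_pow]
      ring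
    rw [e, intervalIntegral.integral_finsetSum]
    · rw [mul_sum]
      refine sum_congr rfl ?_
      intro j _
      rw [intervalIntegral.integral_const_mul, beta_shift _ _ _ hx.2 hρ (hj j),
        show a + j + ((k : ℝ) - s) = a + j - s + k by ring]
      field_simp
    · intro j _
      exact (beta_int x _ _ hx.2 hρ (hj j)).const_mul _
  have hE : Iplus ((k : ℝ) - s) v =ᶠ[nhds y] fun x =>
      ∑ j ∈ range (n + 1), (C * c j * (Real.Gamma (a + j + 1) / Real.Gamma (a + j - s + k + 1))) *
        (1 - x) ^ (a + j - s + k) := by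
    filter_upwards [isOpen_Ioo.mem_nhds hy] with x hx using hI x hx
  unfold Dplus
  have hy0 : 1 - y ≠ 0 := by linarith [hy.2]
  have hy1 : 0 < 1 - y := by linarith [hy.2]
  rw [hE.iteratedDeriv_eq, iteratedDeriv_fun_sum]
  · unfold jacobiP
    rw [mul_sum, mul_sum, mul_sum, mul_sum]
    refine sum_congr rfl ?_
    intro j hjn
    have hjn' : j ≤ n := by simpa [Nat.lt_succ_iff] using hjn
    obtain ⟨r, rfl⟩ := Nat.exists_eq_add_of_le hjn'
    have hpos : 0 < a + j - s + 1 := by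
      have : (0 : ℝ) ≤ j := Nat.cast_nonneg j
      linarith
    have hpos2 : 0 < a + j + 1 := by linarith
    have hpos3 : 0 < a + j - s + k + 1 := by linarith
    rw [iteratedDeriv_const_mul_field, mul_left_comm, iter_pow _ (by linarith) k y hy.2]
    rw [show ((j + r : ℕ) : ℝ) + a + 1 = a + j + 1 + r by push_cast; ring,
      show ((j + r : ℕ) : ℝ) + a - s + 1 = a + j - s + 1 + r by push_cast; ring,
      gamma_asc _ hpos, gamma_asc _ hpos2, hc]
    simp only
    rw [show j + r - j = r by omega,
      show ((j + r : ℕ) : ℝ) + (a - s) + (b + s) + 1 = ((j + r : ℕ) : ℝ) + a + b + 1 by ring,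
      show a - s + j + 1 = a + j - s + 1 by ring,
      show a + j - s = a - s + j by ring, Real.rpow_add hy1, Real.rpow_natCast,
      show (y - 1) / 2 = (-1 / 2) * (1 - y) by ring, mul_pow]
    rw [show a - s + j = a + j - s by ring]
    have g1 := (Real.Gamma_pos_of_pos hpos).ne'
    have g3 := (Real.Gamma_pos_of_pos hpos3).ne'
    have g4 := (ascPochhammer_pos r _ hpos).ne'
    field_simp
  · intro j _
    apply ContDiffAt.mul contDiffAt_const
    exact (contDiffAt_const.sub contDiffAt_id).rpow_const_of_ne hy0

lemma Iminus_eq (ρ : ℝ) (v : ℝ → ℝ) :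
    Iminus ρ v = fun x => Iplus ρ (fun z => v (-z)) (-x) := by
  funext x
  unfold Iminus Iplus
  congr 1
  have h := intervalIntegral.integral_comp_neg (a := -1) (b := x)
    (fun y => (y - -x) ^ (ρ - 1) * v (-y))
  rw [neg_neg] at h
  rw [← h]
  refine intervalIntegral.integral_congr ?_
  intro t _
  simp only [neg_neg]
  congr 2
  ring

lemma Dminus_eq (s : ℝ) (k : ℕ) (v : ℝ → ℝ) (x : ℝ) :
    Dminus s k v x = Dplus s k (fun z => v (-z)) (-x) := by
  unfold Dminus Dplus
  rw [Iminus_eq, iteratedDeriv_comp_neg]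
  simp

/-- Theorem 3.2: GJFs are eigenfunctions of the fractional
Sturm-Liouville operator. -/
theorem stmt10 (s : ℝ) (hs : 0 < s) (k : ℕ) (hk1 : (k : ℝ) - 1 ≤ s) (hk2 : s < k)
    (α β : ℝ) (hα : s - 1 < α) (hβ : -1 < β) (n : ℕ) :
    ∀ x ∈ Set.Ioo (-1 : ℝ) 1,
      Dminus s k
          (fun y => (1 - y) ^ (-α + s) * (1 + y) ^ (β + s) *
            Dplus s k (fun z => (1 - z) ^ α * jacobiP α β n z) y) x =
        Real.Gamma ((n : ℝ) + α + 1) * Real.Gamma ((n : ℝ) + β + s + 1) /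
            (Real.Gamma ((n : ℝ) + α - s + 1) * Real.Gamma ((n : ℝ) + β + 1)) *
          ((1 + x) ^ β * jacobiP α β n x) := by
  intro x hx
  have hx' : -x ∈ Set.Ioo (-1 : ℝ) 1 := ⟨by linarith [hx.2], by linarith [hx.1]⟩
  rw [Dminus_eq, Dplus_jacobi s k hk2 (β + s) (α - s)
    (Real.Gamma (n + α + 1) / Real.Gamma (n + α - s + 1) * (-1) ^ n) hs (by linarith) n _ _ (-x) hx']
  · rw [show β + s - s = β by ring, show α - s + s = α by ring, jacobi_neg,
      show (n : ℝ) + (β + s) + 1 = n + β + s + 1 by ring,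
      show (n : ℝ) + (β + s) - s + 1 = n + β + 1 by ring, sub_neg_eq_add]
    have : ((-1 : ℝ) ^ n) * (-1) ^ n = 1 := by rw [← mul_pow]; simp
    calc _ = (Real.Gamma (n + α + 1) / Real.Gamma (n + α - s + 1) *
          (Real.Gamma (n + β + s + 1) / Real.Gamma (n + β + 1) *
            ((1 + x) ^ β * jacobiP α β n x))) * (((-1 : ℝ) ^ n) * (-1) ^ n) := by ring
      _ = _ := by rw [this]; ring
  · intro z hz
    have hz' : -z ∈ Set.Ioo (-1 : ℝ) 1 := ⟨by linarith [hz.2], by linarith [hz.1]⟩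
    have hz1 : 0 < 1 + z := by linarith [hz.1]
    rw [Dplus_jacobi s k hk2 α β 1 hs hα n _ (fun w _ => by ring) (-z) hz', jacobi_neg,
      sub_neg_eq_add, ← sub_eq_add_neg, show -α + s = -(α - s) by ring, Real.rpow_neg hz1.le]
    have := (Real.rpow_pos_of_pos hz1 (α - s)).ne'
    field_simp
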